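/- Let G be a connected graph contractible to K_{2,3} with bags V1,...,V5 (V1,V3,V5 on one side, V2,V4 on the other), where V2 and V4 induce connected subgraphs, |V1| = |V2| = 1, V3 induces a connected subgraph, and there is a vertex v4 ∈ V4 with E_G({v4},V3) ≠ ∅ and E_G({v4},V5) = E_G(V4,V5). Then G does not belong to G^cs. -/

import Mathlib

open SimpleGraph
open scoped Classical

variable {V : Type*} [Fintype V]

noncomputable def setWeight (w : V → ℝ) (A : Set V) : ℝ :=
  ∑ v : V, if v ∈ A then w v else 0

def IsComponentOf (G : SimpleGraph V) (S C : Set V) : Prop :=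
  ∃ c : (G.induce S).ConnectedComponent,
    C = Subtype.val '' {x : ↥S | (G.induce S).connectedComponentMk x = c}

def Touches (G : SimpleGraph V) (C D : Set V) : Prop :=
  ∃ a ∈ C, ∃ b ∈ D, G.Adj a b

def IsSafeSet (G : SimpleGraph V) (w : V → ℝ) (S : Set V) : Prop :=
  S.Nonempty ∧ S ≠ Set.univ ∧
    ∀ C D : Set V, IsComponentOf G S C → IsComponentOf G Sᶜ D → Touches G C D →
      setWeight w D ≤ setWeight w C

def IsConnSafeSet (G : SimpleGraph V) (w : V → ℝ) (S : Set V) : Prop :=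
  IsSafeSet G w S ∧ (G.induce S).Connected

noncomputable def safeNumber (G : SimpleGraph V) (w : V → ℝ) : ℝ :=
  sInf (setWeight w '' {S | IsSafeSet G w S})

noncomputable def connSafeNumber (G : SimpleGraph V) (w : V → ℝ) : ℝ :=
  sInf (setWeight w '' {S | IsConnSafeSet G w S})

def InGcs (G : SimpleGraph V) : Prop :=
  ∀ w : V → ℝ, (∀ v, 0 < w v) → safeNumber G w = connSafeNumber G w

def ContractibleTo {W : Type*} (G : SimpleGraph V) (H : SimpleGraph W) (φ : V → W) : Prop :=
  Function.Surjective φ ∧ ∀ i j : W, i ≠ j →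
    ((∃ a b : V, φ a = i ∧ φ b = j ∧ G.Adj a b) ↔ H.Adj i j)

/-- The graph `H₃ = K₍₂,₃₎` with partite sets `{u₁,u₃,u₅}` (vertices `0,2,4`) and
`{u₂,u₄}` (vertices `1,3`). -/
def H3graph : SimpleGraph (Fin 5) :=
  SimpleGraph.fromRel (fun i j =>
    (i, j) ∈ [((0 : Fin 5), (1 : Fin 5)), (2, 1), (4, 1), (0, 3), (2, 3), (4, 3)])

set_option linter.unusedSectionVars false

lemma sw_mono {w : V → ℝ} (hw : ∀ v, 0 < w v) {A B : Set V} (h : A ⊆ B) :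
    setWeight w A ≤ setWeight w B := by
  unfold setWeight
  apply Finset.sum_le_sum
  intro v _
  by_cases h1 : v ∈ A
  · simp [h1, h h1]
  · simp only [h1, if_false]
    split_ifs
    · exact (hw v).le
    · exact le_rfl

lemma sw_union {w : V → ℝ} {A B : Set V} (h : ∀ v, v ∈ A → v ∉ B) :
    setWeight w (A ∪ B) = setWeight w A + setWeight w B := by
  unfold setWeight
  rw [← Finset.sum_add_distrib]
  apply Finset.sum_congr rfl
  intro v _
  have := h v
  by_cases h1 : v ∈ A <;> by_cases h2 : v ∈ B <;> simp_all

lemma sw_single {w : V → ℝ} (a : V) : setWeight w {a} = w a := by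
  simp [setWeight]

lemma sw_empty {w : V → ℝ} : setWeight w ∅ = 0 := by
  simp [setWeight]

lemma sw_nonneg {w : V → ℝ} (hw : ∀ v, 0 < w v) (A : Set V) : 0 ≤ setWeight w A := by
  rw [← sw_empty (w := w)]
  exact sw_mono hw (Set.empty_subset _)

lemma sw_mem {w : V → ℝ} (hw : ∀ v, 0 < w v) {A : Set V} {a : V} (h : a ∈ A) :
    w a ≤ setWeight w A := by
  rw [← sw_single (w := w) a]
  exact sw_mono hw (by simpa using h)

lemma sw_not_mem {w : V → ℝ} (hw : ∀ v, 0 < w v) {A B : Set V} {a : V} (h : A ⊆ B)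
    (ha : a ∈ B) (hA : a ∉ A) : setWeight w A + w a ≤ setWeight w B := by
  rw [← sw_single (w := w) a, ← sw_union (by rintro v hv rfl; exact hA hv)]
  exact sw_mono hw (by simpa [Set.insert_subset_iff] using ⟨ha, h⟩)

lemma sw_congr {w u : V → ℝ} {A : Set V} (h : ∀ v ∈ A, w v = u v) :
    setWeight w A = setWeight u A := by
  unfold setWeight
  apply Finset.sum_congr rfl
  intro v _
  split_ifs with h1
  · exact h v h1
  · rfl

/-- cut lemma -/
lemma cut {G : SimpleGraph V} {T : Set V} (hT : (G.induce T).Preconnected) (P : V → Prop)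
    (hP : ∀ y ∈ T, ∀ z ∈ T, P y → G.Adj y z → P z) {x : V} (hx : x ∈ T) (hPx : P x) :
    ∀ y ∈ T, P y := by
  intro y hy
  obtain ⟨p⟩ := hT ⟨x, hx⟩ ⟨y, hy⟩
  have : ∀ (u v : T), (G.induce T).Walk u v → P u → P v := by
    intro u v p
    induction p with
    | nil => exact id
    | @cons u v w h p ih =>
      intro hu
      exact ih (hP u u.2 v v.2 hu h)
  exact this _ _ p hPx

lemma comp_mem {G : SimpleGraph V} {S C : Set V} (h : IsComponentOf G S C) :
    ∃ x ∈ C, x ∈ S := by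
  obtain ⟨c, rfl⟩ := h
  induction c using SimpleGraph.ConnectedComponent.ind with
  | _ v => exact ⟨v, ⟨v, rfl, rfl⟩, v.2⟩

lemma comp_sub {G : SimpleGraph V} {S C : Set V} (h : IsComponentOf G S C) : C ⊆ S := by
  obtain ⟨c, rfl⟩ := h
  rintro _ ⟨x, _, rfl⟩
  exact x.2

lemma comp_closed {G : SimpleGraph V} {S C : Set V} (h : IsComponentOf G S C) {y z : V}
    (hy : y ∈ C) (hz : z ∈ S) (hyz : G.Adj y z) : z ∈ C := by
  obtain ⟨c, rfl⟩ := h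
  obtain ⟨x, hx, rfl⟩ := hy
  refine ⟨⟨z, hz⟩, ?_, rfl⟩
  rw [← hx]
  apply SimpleGraph.ConnectedComponent.sound
  exact (SimpleGraph.Adj.reachable (G := G.induce S) (u := x) (v := ⟨z, hz⟩) hyz).symm

lemma comp_cut {G : SimpleGraph V} {S C : Set V} (h : IsComponentOf G S C) (P : V → Prop)
    (hP : ∀ y ∈ S, ∀ z ∈ S, P y → G.Adj y z → P z) {x : V} (hx : x ∈ C) (hPx : P x) :
    ∀ y ∈ C, P y := by
  obtain ⟨c, rfl⟩ := h
  obtain ⟨x, hx, rfl⟩ := hx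
  rintro _ ⟨y, hy, rfl⟩
  have hr : (G.induce S).Reachable x y := by
    apply SimpleGraph.ConnectedComponent.exact
    rw [hx, hy]
  obtain ⟨p⟩ := hr
  have : ∀ (u v : S), (G.induce S).Walk u v → P u → P v := by
    intro u v p
    induction p with
    | nil => exact id
    | @cons u v w h p ih =>
      intro hu
      exact ih (hP u u.2 v v.2 hu h)
  exact this _ _ p hPx

lemma comp_exists {G : SimpleGraph V} {S : Set V} {x : V} (hx : x ∈ S) :
    ∃ C, IsComponentOf G S C ∧ x ∈ C :=
  ⟨_, ⟨(G.induce S).connectedComponentMk ⟨x, hx⟩, rfl⟩, ⟨x, hx⟩, rfl, rfl⟩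

lemma connsafe_comp {G : SimpleGraph V} (hG : G.Connected) {w : V → ℝ} {S : Set V}
    (hw : ∀ v, 0 < w v)
    (hS : IsConnSafeSet G w S) {v : V} (hv : v ∉ S) :
    ∃ K : Set V, v ∈ K ∧ (∀ y z, y ∈ K → G.Adj y z → z ∉ S → z ∈ K) ∧
      setWeight w K ≤ setWeight w S := by
  obtain ⟨K, hK, hvK⟩ := comp_exists (G := G) (S := Sᶜ) hv
  refine ⟨K, hvK, fun y z hy hyz hz => comp_closed hK hy hz hyz, ?_⟩
  have hS' := hS
  obtain ⟨⟨⟨s, hs⟩, -, hsafe⟩, hconn⟩ := hS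
  have ht : ∃ y ∈ K, ∃ z ∈ S, G.Adj y z := by
    by_contra! hcon
    obtain ⟨p⟩ := hG.preconnected v s
    have : ∀ (u v : V), G.Walk u v → u ∈ K → v ∈ K := by
      intro u v p
      induction p with
      | nil => exact id
      | @cons u v w h p ih =>
        intro hu
        refine ih (comp_closed hK hu ?_ h)
        intro hvS
        exact hcon u hu v hvS h
    exact comp_sub hK (this _ _ p hvK) hs
  obtain ⟨y, hy, z, hz, hyz⟩ := ht
  obtain ⟨C, hC, hzC⟩ := comp_exists (G := G) hz
  exact (hsafe C K hC hK ⟨z, hzC, y, hy, hyz.symm⟩).trans (sw_mono hw (comp_sub hC))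

lemma conc (T : Set V) (a : V) (ha : a ∈ T) (θ : ℝ) (h0 : 0 < θ) (h1 : θ < 1) :
    ∃ u : V → ℝ, (∀ v, 0 < u v) ∧ setWeight u T = 1 ∧ 1 - θ ≤ u a := by
  have hn : (0:ℝ) < Fintype.card V := by
    have : 0 < Fintype.card V := Fintype.card_pos_iff.mpr ⟨a⟩
    exact_mod_cast this
  let u0 : V → ℝ := fun _ => θ / Fintype.card V
  have hu0 : ∀ v, 0 < u0 v := fun v => by positivity
  let r := setWeight u0 (T \ {a})
  have hr : r ≤ θ := by
    have : r ≤ setWeight u0 Set.univ := sw_mono hu0 (Set.subset_univ _)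
    refine this.trans ?_
    simp only [setWeight, u0, Set.mem_univ, if_true, Finset.sum_const, Finset.card_univ,
      nsmul_eq_mul]
    rw [mul_div_cancel₀ _ hn.ne']
  refine ⟨fun v => if v = a then 1 - r else u0 v, ?_, ?_, ?_⟩
  · intro v
    dsimp only
    split_ifs
    · linarith
    · exact hu0 v
  · have : T = (T \ {a}) ∪ {a} := by
      ext x; by_cases hx : x = a <;> simp [hx, ha]
    rw [this, sw_union (by rintro v ⟨_, h⟩; exact h), sw_single]
    rw [sw_congr (u := u0)]
    · simp [r]
    · rintro v ⟨_, hv⟩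
      simp only [Set.mem_singleton_iff] at hv
      simp [hv]
  · simp only [if_true]
    linarith

lemma exists_lb (ι : Type*) [Finite ι] (f : ι → ℝ) : ∃ δ > 0, ∀ i, 0 < f i → δ ≤ f i := by
  have := Fintype.ofFinite ι
  by_cases h : ∃ i, 0 < f i
  · have hne : (Finset.univ.filter (fun i => 0 < f i)).Nonempty := by
      obtain ⟨i, hi⟩ := h
      exact ⟨i, by simpa using hi⟩
    obtain ⟨i, hi, hmin⟩ := Finset.exists_min_image _ f hne
    refine ⟨f i, by simpa using hi, fun j hj => hmin j (by simpa using hj)⟩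
  · push Not at h
    exact ⟨1, one_pos, fun i hi => absurd hi (not_lt.mpr (h i))⟩

/-- weights on the fifth bag: every component has total weight one -/
lemma weight5 (G : SimpleGraph V) (B : Set V) :
    ∃ (u : V → ℝ) (D : V → Set V), (∀ v, 0 < u v) ∧ ∀ x ∈ B, x ∈ D x ∧ D x ⊆ B ∧
      setWeight u (D x) = 1 ∧
      (∀ y ∈ D x, ∀ z ∈ B, G.Adj y z → z ∈ D x) ∧
      (∀ P : V → Prop, P x → (∀ y ∈ D x, ∀ z ∈ D x, P y → G.Adj y z → P z) →
        ∀ y ∈ D x, P y) := by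
  let D : V → Set V := fun x =>
    {y | Relation.ReflTransGen (fun p q => G.Adj p q ∧ p ∈ B ∧ q ∈ B) x y}
  have hsymm : ∀ x y, y ∈ D x → x ∈ D y := by
    intro x y h
    change Relation.ReflTransGen _ x y at h
    induction h with
    | refl => exact Relation.ReflTransGen.refl
    | tail _ h2 ih => exact Relation.ReflTransGen.head ⟨h2.1.symm, h2.2.2, h2.2.1⟩ ih
  have heq : ∀ x y, y ∈ D x → D y = D x := by
    intro x y h
    ext z
    exact ⟨fun hz => Relation.ReflTransGen.trans h hz,
      fun hz => Relation.ReflTransGen.trans (hsymm _ _ h) hz⟩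
  have hself : ∀ x, x ∈ D x := fun x => Relation.ReflTransGen.refl
  let N : Set V → ℝ := fun A => setWeight (fun _ => (1:ℝ)) A
  have hN : ∀ x, 0 < N (D x) := by
    intro x
    have : (1:ℝ) ≤ N (D x) := sw_mem (w := fun _ => (1:ℝ)) (fun _ => one_pos) (hself x)
    linarith
  refine ⟨fun x => 1 / N (D x), D, fun v => one_div_pos.mpr (hN v), ?_⟩
  intro x hx
  refine ⟨hself x, ?_, ?_, ?_, ?_⟩
  · intro y hy
    rcases Relation.ReflTransGen.cases_tail hy with h | ⟨c, _, h⟩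
    · rw [h]; exact hx
    · exact h.2.2
  · rw [sw_congr (u := fun _ => 1 / N (D x))]
    · have : setWeight (fun _ : V => 1 / N (D x)) (D x) = (1 / N (D x)) * N (D x) := by
        conv_rhs => simp only [N]
        unfold setWeight
        rw [Finset.mul_sum]
        apply Finset.sum_congr rfl
        intro v _
        split_ifs <;> simp [N, setWeight]
      rw [this, one_div_mul_cancel (hN x).ne']
    · intro y hy
      simp only [heq x y hy]
  · intro y hy z hz hyz
    have hyB : y ∈ B := by
      rcases Relation.ReflTransGen.cases_tail hy with h | ⟨c, _, h⟩
      · rw [h]; exact hx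
      · exact h.2.2
    exact Relation.ReflTransGen.tail hy ⟨hyz, hyB, hz⟩
  · intro P hPx hP y hy
    have : y ∈ D x ∧ P y := by
      induction hy with
      | refl => exact ⟨hself x, hPx⟩
      | tail h1 h2 ih =>
        have hz := Relation.ReflTransGen.tail h1 h2
        exact ⟨hz, hP _ h1 _ hz ih.2 h2.1⟩
    exact this.2

lemma sw_parts (w : V → ℝ) (φ : V → Fin 5) (T : Set V) :
    setWeight w T = setWeight w (T ∩ φ ⁻¹' {0}) + setWeight w (T ∩ φ ⁻¹' {1})
      + setWeight w (T ∩ φ ⁻¹' {2}) + setWeight w (T ∩ φ ⁻¹' {3})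
      + setWeight w (T ∩ φ ⁻¹' {4}) := by
  unfold setWeight
  simp only [← Finset.sum_add_distrib]
  apply Finset.sum_congr rfl
  intro v _
  by_cases hv : v ∈ T
  · simp only [hv, Set.mem_inter_iff, Set.mem_preimage, Set.mem_singleton_iff, true_and, if_true]
    have : ∀ i : Fin 5, i = 0 ∨ i = 1 ∨ i = 2 ∨ i = 3 ∨ i = 4 := by decide
    rcases this (φ v) with h | h | h | h | h <;> simp [h]
  · simp [hv]

lemma H3_adj : ∀ i j : Fin 5, H3graph.Adj i j ↔
    (((i = 1 ∨ i = 3) ∧ (j = 0 ∨ j = 2 ∨ j = 4)) ∨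
      ((j = 1 ∨ j = 3) ∧ (i = 0 ∨ i = 2 ∨ i = 4))) := by
  intro i j
  fin_cases i <;> fin_cases j <;> simp [H3graph]

/-- the combinatorial core -/
lemma no_small_conn (G : SimpleGraph V) (φ : V → Fin 5) (w : V → ℝ) (hw : ∀ v, 0 < w v)
    (hadj : ∀ x y, G.Adj x y → φ x = φ y ∨ H3graph.Adj (φ x) (φ y))
    (v1 v2 v4 a : V) (D : V → Set V) (δ η θ ε : ℝ)
    (hv1 : ∀ v, φ v = 0 ↔ v = v1) (hv2 : ∀ v, φ v = 1 ↔ v = v2)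
    (hv4 : φ v4 = 3) (ha : φ a = 2) (hva : G.Adj v4 a)
    (h12 : G.Adj v1 v2) (h14 : ∃ p, φ p = 3 ∧ G.Adj v1 p)
    (h23 : ∃ b, φ b = 2 ∧ G.Adj v2 b)
    (h25 : ∃ d, φ d = 4 ∧ G.Adj v2 d)
    (h45 : ∃ d, φ d = 4 ∧ G.Adj v4 d)
    (hv4V5 : ∀ b c, φ b = 3 → φ c = 4 → G.Adj b c → b = v4)
    (h3conn : (G.induce (φ ⁻¹' {2})).Preconnected)
    (h4conn : (G.induce (φ ⁻¹' {3})).Preconnected)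
    (hδ : 0 < δ) (hη : 0 < η) (hθ : 0 < θ) (hε : 0 < ε)
    (hδ1 : δ ≤ 1) (hηδ : 10 * η ≤ δ) (hθδ : 10 * θ ≤ δ) (hεη : 10 * ε ≤ η)
    (w1 : w v1 = 1) (w2 : w v2 = 1) (W3 : setWeight w (φ ⁻¹' {2}) = 1)
    (W4 : setWeight w (φ ⁻¹' {3}) = 1)
    (wa : 1 - θ ≤ w a) (wv4 : 1 - ε ≤ w v4) (w3 : ∀ v, φ v = 2 → η ≤ w v)
    (w5 : ∀ v, φ v = 4 → δ ≤ w v)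
    (gap : ∀ T : Set V, T ⊆ φ ⁻¹' {4} → setWeight w T < 1 → setWeight w T ≤ 1 - δ)
    (hD : ∀ x, φ x = 4 → D x ⊆ φ ⁻¹' {4} ∧ setWeight w (D x) = 1 ∧
      (∀ P : V → Prop, P x → (∀ y ∈ D x, ∀ z ∈ D x, P y → G.Adj y z → P z) →
        ∀ y ∈ D x, P y))
    (S : Set V) (hne : S.Nonempty) (hSc : (G.induce S).Preconnected) (hS2 : setWeight w S ≤ 2)
    (hK : ∀ v, v ∉ S → ∃ K : Set V, v ∈ K ∧ (∀ y z, y ∈ K → G.Adj y z → z ∉ S → z ∈ K) ∧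
      setWeight w K ≤ setWeight w S) : False := by
  have hφ1 : φ v1 = 0 := (hv1 v1).2 rfl
  have hφ2 : φ v2 = 1 := (hv2 v2).2 rfl
  have all5 : ∀ i : Fin 5, i = 0 ∨ i = 1 ∨ i = 2 ∨ i = 3 ∨ i = 4 := by decide
  have e0 : φ ⁻¹' {0} = {v1} := by ext x; simp [hv1]
  have e1 : φ ⁻¹' {1} = {v2} := by ext x; simp [hv2]
  -- weights of the parts
  have nn : ∀ (T : Set V), 0 ≤ setWeight w T := sw_nonneg hw
  have t0 : ∀ T : Set V, v1 ∈ T → setWeight w (T ∩ φ ⁻¹' {0}) = 1 := by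
    intro T h
    rw [e0, Set.inter_eq_right.mpr (by simpa using h), sw_single, w1]
  have t0n : ∀ T : Set V, v1 ∉ T → setWeight w (T ∩ φ ⁻¹' {0}) = 0 := by
    intro T h
    rw [e0, Set.inter_singleton_eq_empty.mpr h, sw_empty]
  have t1 : ∀ T : Set V, v2 ∈ T → setWeight w (T ∩ φ ⁻¹' {1}) = 1 := by
    intro T h
    rw [e1, Set.inter_eq_right.mpr (by simpa using h), sw_single, w2]
  have t1n : ∀ T : Set V, v2 ∉ T → setWeight w (T ∩ φ ⁻¹' {1}) = 0 := by
    intro T h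
    rw [e1, Set.inter_singleton_eq_empty.mpr h, sw_empty]
  have t2le : ∀ T : Set V, setWeight w (T ∩ φ ⁻¹' {2}) ≤ 1 := by
    intro T; rw [← W3]; exact sw_mono hw Set.inter_subset_right
  have t2a : ∀ T : Set V, a ∈ T → 1 - θ ≤ setWeight w (T ∩ φ ⁻¹' {2}) := by
    intro T h
    exact wa.trans (sw_mem hw ⟨h, ha⟩)
  have t2an : ∀ T : Set V, a ∉ T → setWeight w (T ∩ φ ⁻¹' {2}) ≤ θ := by
    intro T h
    have := sw_not_mem hw (A := T ∩ φ ⁻¹' {2}) Set.inter_subset_right ha (fun h' => h h'.1)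
    linarith
  have t2x : ∀ (T : Set V) x, φ x = 2 → x ∈ T → η ≤ setWeight w (T ∩ φ ⁻¹' {2}) := by
    intro T x hx h
    exact (w3 x hx).trans (sw_mem hw ⟨h, hx⟩)
  have t2lt : ∀ (T : Set V), setWeight w (T ∩ φ ⁻¹' {2}) < 1 →
      setWeight w (T ∩ φ ⁻¹' {2}) ≤ 1 - η := by
    intro T h
    by_contra hcon
    have : φ ⁻¹' {2} ⊆ T := by
      intro x hx
      by_contra hxT
      have := sw_not_mem hw (A := T ∩ φ ⁻¹' {2}) Set.inter_subset_right hx (fun h' => hxT h'.1)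
      have := w3 x hx
      linarith
    rw [Set.inter_eq_right.mpr this] at h
    linarith
  have t2full : ∀ (T : Set V), (∀ x, φ x = 2 → x ∈ T) → setWeight w (T ∩ φ ⁻¹' {2}) = 1 := by
    intro T h
    rw [Set.inter_eq_right.mpr (show φ ⁻¹' {2} ⊆ T from fun x hx => h x hx), W3]
  have t3le : ∀ T : Set V, setWeight w (T ∩ φ ⁻¹' {3}) ≤ 1 := by
    intro T; rw [← W4]; exact sw_mono hw Set.inter_subset_right
  have t3v : ∀ T : Set V, v4 ∈ T → 1 - ε ≤ setWeight w (T ∩ φ ⁻¹' {3}) := by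
    intro T h
    exact wv4.trans (sw_mem hw ⟨h, hv4⟩)
  have t3vn : ∀ T : Set V, v4 ∉ T → setWeight w (T ∩ φ ⁻¹' {3}) ≤ ε := by
    intro T h
    have := sw_not_mem hw (A := T ∩ φ ⁻¹' {3}) Set.inter_subset_right hv4 (fun h' => h h'.1)
    linarith
  have t3x : ∀ (T : Set V) x, φ x = 3 → x ∈ T → 0 < setWeight w (T ∩ φ ⁻¹' {3}) := by
    intro T x hx h
    exact (hw x).trans_le (sw_mem hw ⟨h, hx⟩)
  have t3full : ∀ (T : Set V), (∀ x, φ x = 3 → x ∈ T) → setWeight w (T ∩ φ ⁻¹' {3}) = 1 := by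
    intro T h
    rw [Set.inter_eq_right.mpr (show φ ⁻¹' {3} ⊆ T from fun x hx => h x hx), W4]
  have t4x : ∀ (T : Set V) x, φ x = 4 → x ∈ T → δ ≤ setWeight w (T ∩ φ ⁻¹' {4}) := by
    intro T x hx h
    exact (w5 x hx).trans (sw_mem hw ⟨h, hx⟩)
  have t4n : ∀ (T : Set V), (∀ x, φ x = 4 → x ∉ T) → setWeight w (T ∩ φ ⁻¹' {4}) = 0 := by
    intro T h
    have : T ∩ φ ⁻¹' {4} = ∅ := by
      ext x
      simp only [Set.mem_inter_iff, Set.mem_preimage, Set.mem_singleton_iff,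
        Set.mem_empty_iff_false, iff_false]
      exact fun h' => h x h'.2 h'.1
    rw [this, sw_empty]
  have t4gap : ∀ (T : Set V), 1 - δ < setWeight w (T ∩ φ ⁻¹' {4}) →
      1 ≤ setWeight w (T ∩ φ ⁻¹' {4}) := by
    intro T h
    by_contra hcon
    have := gap (T ∩ φ ⁻¹' {4}) Set.inter_subset_right (not_le.mp hcon)
    linarith
  have t4D : ∀ (T : Set V) x, φ x = 4 → D x ⊆ T → 1 ≤ setWeight w (T ∩ φ ⁻¹' {4}) := by
    intro T x hx h
    rw [← (hD x hx).2.1]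
    exact sw_mono hw (fun y hy => ⟨h hy, (hD x hx).1 hy⟩)
  have sp := sw_parts w φ
  have spS := sp S
  have n0 := nn (S ∩ φ ⁻¹' {0})
  have n1 := nn (S ∩ φ ⁻¹' {1})
  have n2 := nn (S ∩ φ ⁻¹' {2})
  have n3 := nn (S ∩ φ ⁻¹' {3})
  have n4 := nn (S ∩ φ ⁻¹' {4})
  obtain ⟨p, hp, hp1⟩ := h14
  obtain ⟨b, hb, hb2⟩ := h23
  obtain ⟨d2, hd2, hd2'⟩ := h25
  obtain ⟨d4, hd4, hd4'⟩ := h45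
  -- absorbing bags into K
  have abs3 : ∀ K : Set V, (∀ y z, y ∈ K → G.Adj y z → z ∉ S → z ∈ K) →
      (∀ x, φ x = 2 → x ∉ S) → ∀ x, φ x = 2 → x ∈ K → ∀ y, φ y = 2 → y ∈ K := by
    intro K hcl hS x hx hxK
    exact cut h3conn (fun y => y ∈ K) (fun y _ z hz hy hyz => hcl y z hy hyz (hS z hz)) hx hxK
  have abs4 : ∀ K : Set V, (∀ y z, y ∈ K → G.Adj y z → z ∉ S → z ∈ K) →
      (∀ x, φ x = 3 → x ∉ S) → ∀ x, φ x = 3 → x ∈ K → ∀ y, φ y = 3 → y ∈ K := by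
    intro K hcl hS x hx hxK
    exact cut h4conn (fun y => y ∈ K) (fun y _ z hz hy hyz => hcl y z hy hyz (hS z hz)) hx hxK
  have absD : ∀ K : Set V, (∀ y z, y ∈ K → G.Adj y z → z ∉ S → z ∈ K) →
      ∀ x, φ x = 4 → (∀ y ∈ D x, y ∉ S) → x ∈ K → D x ⊆ K := by
    intro K hcl x hx hS hxK
    exact (hD x hx).2.2 (fun y => y ∈ K) hxK (fun y _ z hz hy hyz => hcl y z hy hyz (hS z hz))
  have xD : ∀ x, φ x = 4 → x ∈ D x := by
    intro x hx
    by_contra hcon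
    have := (hD x hx).2.2 (fun y => y = x) rfl
      (fun y hy z hz hyx _ => absurd (hyx ▸ hy) hcon)
    have : D x = ∅ := by
      ext y
      simp only [Set.mem_empty_iff_false, iff_false]
      intro hy
      exact hcon (this y hy ▸ hy)
    have h1 := (hD x hx).2.1
    rw [this, sw_empty] at h1
    norm_num at h1
  by_cases c2 : v2 ∈ S
  · have s1 := t1 S c2
    by_cases c4 : v4 ∈ S
    · -- both
      have s3 := t3v S c4
      have : ∃ x ∈ S, φ x ≠ 1 ∧ φ x ≠ 3 := by
        by_contra! hcon
        have := cut hSc (fun x => φ x = 1) (fun y hy z hz hy1 hyz => by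
          by_contra hz1
          have h3 := hcon z hz hz1
          rcases hadj y z hyz with h | h
          · exact hz1 (h ▸ hy1)
          · rw [hy1, h3, H3_adj] at h
            revert h; decide) c2 hφ2 v4 c4
        rw [hv4] at this
        revert this; decide
      obtain ⟨x, hx, hx1, hx3⟩ := this
      rcases all5 (φ x) with h | h | h | h | h
      · have := t0 S ((hv1 x).1 h ▸ hx)
        linarith
      · exact hx1 h
      · have := t2x S x h hx
        linarith
      · exact hx3 h
      · have := t4x S x h hx
        linarith
    · obtain ⟨K, h4K, hcl, hKS⟩ := hK v4 c4
      have spK := sp K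
      have k0 := nn (K ∩ φ ⁻¹' {0})
      have k1 := nn (K ∩ φ ⁻¹' {1})
      have k2 := nn (K ∩ φ ⁻¹' {2})
      have k3 := t3v K h4K
      have k4 := nn (K ∩ φ ⁻¹' {4})
      have s3 := t3vn S c4
      by_cases ca : a ∈ S
      · have s2 := t2a S ca
        have c1 : v1 ∉ S := by
          intro h
          have := t0 S h
          linarith
        have c5 : ∀ x, φ x = 4 → x ∉ S := by
          intro x hx h
          have := t4x S x hx h
          linarith
        have kD := t4D K d4 hd4 (absD K hcl d4 hd4 (fun y hy => c5 y ((hD d4 hd4).1 hy))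
          (hcl _ _ h4K hd4' (c5 d4 hd4)))
        have s0 := t0n S c1
        have s4 := t4n S c5
        by_cases cV4 : ∃ x, φ x = 3 ∧ x ∈ S
        · obtain ⟨x, hx, hxS⟩ := cV4
          have := t3x S x hx hxS
          have := t2lt S (by linarith)
          linarith
        · push Not at cV4
          have h4 := abs4 K hcl cV4 v4 hv4 h4K
          have := t3full K h4
          have := t0 K (hcl p v1 (h4 p hp) hp1.symm c1)
          linarith
      · have s2 := t2an S ca
        have k2 := t2a K (hcl _ _ h4K hva ca)
        by_cases cD : ∀ y ∈ D d4, y ∉ S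
        · have kD := t4D K d4 hd4 (absD K hcl d4 hd4 cD
            (hcl _ _ h4K hd4' (cD _ (xD d4 hd4))))
          linarith
        · push Not at cD
          obtain ⟨x, hxD, hxS⟩ := cD
          have s4 := t4x S x ((hD d4 hd4).1 hxD) hxS
          have c1 : v1 ∉ S := by
            intro h
            have := t0 S h
            linarith
          have s0 := t0n S c1
          by_cases cV4 : ∃ x, φ x = 3 ∧ x ∈ S
          · obtain ⟨y, hy, hyS⟩ := cV4
            have : ∃ z, φ z = 2 ∧ z ∈ S := by
              by_contra! hcon
              have := cut hSc (fun x => φ x = 3) (fun u hu z hz hu3 huz => by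
                by_contra hz3
                rcases all5 (φ z) with h | h | h | h | h
                · exact c1 ((hv1 z).1 h ▸ hz)
                · rcases hadj u z huz with h' | h'
                  · exact hz3 (h' ▸ hu3)
                  · rw [hu3, h, H3_adj] at h'
                    revert h'; decide
                · exact hcon z h hz
                · exact hz3 h
                · exact c4 (hv4V5 u z hu3 h huz ▸ hu)) hyS hy v2 c2
              rw [hφ2] at this
              revert this; decide
            obtain ⟨z, hz, hzS⟩ := this
            have := t2x S z hz hzS
            have := t4gap S (by linarith)
            linarith
          · push Not at cV4
            have h4 := abs4 K hcl cV4 v4 hv4 h4K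
            have := t0 K (hcl p v1 (h4 p hp) hp1.symm c1)
            linarith
  · have s1 := t1n S c2
    obtain ⟨K, h2K, hcl, hKS⟩ := hK v2 c2
    have spK := sp K
    have k0 := nn (K ∩ φ ⁻¹' {0})
    have k1 := t1 K h2K
    have k2 := nn (K ∩ φ ⁻¹' {2})
    have k3 := nn (K ∩ φ ⁻¹' {3})
    have k4 := nn (K ∩ φ ⁻¹' {4})
    have sl2 := t2le S
    have sl3 := t3le S
    by_cases c4 : v4 ∈ S
    · have s3 := t3v S c4
      by_cases c1 : v1 ∈ S
      · have s0 := t0 S c1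
        have c3 : ∀ x, φ x = 2 → x ∉ S := by
          intro x hx h
          have := t2x S x hx h
          linarith
        have c5 : ∀ x, φ x = 4 → x ∉ S := by
          intro x hx h
          have := t4x S x hx h
          linarith
        have kD := t4D K d2 hd2 (absD K hcl d2 hd2 (fun y hy => c5 y ((hD d2 hd2).1 hy))
          (hcl _ _ h2K hd2' (c5 d2 hd2)))
        have := t2full K (abs3 K hcl c3 b hb (hcl _ _ h2K hb2 (c3 b hb)))
        linarith
      · have s0 := t0n S c1
        have k0 := t0 K (hcl _ _ h2K h12.symm c1)
        have cb : b ∈ S := by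
          by_contra h
          have := t2x K b hb (hcl _ _ h2K hb2 h)
          linarith
        have cd : d2 ∈ S := by
          by_contra h
          have := t4x K d2 hd2 (hcl _ _ h2K hd2' h)
          linarith
        have sb := t2x S b hb cb
        have sd := t4x S d2 hd2 cd
        by_cases ca : a ∈ S
        · have := t2a S ca
          linarith
        · have := t2an S ca
          have := t4gap S (by linarith)
          linarith
    · have s3 := t3vn S c4
      by_cases c5 : ∃ x, φ x = 4 ∧ x ∈ S
      · obtain ⟨x, hx, hxS⟩ := c5
        have hall := cut hSc (fun x => φ x = 4) (fun u hu z hz hu4 huz => by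
          by_contra hz4
          rcases hadj u z huz with h' | h'
          · exact hz4 (h' ▸ hu4)
          · rcases all5 (φ z) with h | h | h | h | h
            · rw [hu4, h, H3_adj] at h'
              revert h'; decide
            · exact c2 ((hv2 z).1 h ▸ hz)
            · rw [hu4, h, H3_adj] at h'
              revert h'; decide
            · exact c4 (hv4V5 z u h hu4 huz.symm ▸ hz)
            · exact hz4 h) hxS hx
        have nS : ∀ y, φ y ≠ 4 → y ∉ S := fun y hy h => hy (hall y h)
        have h1K := hcl _ _ h2K h12.symm (nS v1 (by rw [hφ1]; decide))
        have := t0 K h1K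
        have := t3full K (abs4 K hcl (fun x hx => nS x (by rw [hx]; decide)) p hp
          (hcl _ _ h1K hp1 (nS p (by rw [hp]; decide))))
        have := t2full K (abs3 K hcl (fun x hx => nS x (by rw [hx]; decide)) b hb
          (hcl _ _ h2K hb2 (nS b (by rw [hb]; decide))))
        linarith
      · push Not at c5
        have kD := t4D K d2 hd2 (absD K hcl d2 hd2 (fun y hy => c5 y ((hD d2 hd2).1 hy))
          (hcl _ _ h2K hd2' (c5 d2 hd2)))
        have s4 := t4n S c5
        have c1 : v1 ∈ S := by
          by_contra h
          have := t0n S h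
          linarith
        have s0 := t0 S c1
        have : ∃ x, φ x = 3 ∧ x ∈ S := by
          by_contra! hcon
          have hall := cut hSc (fun x => φ x = 0) (fun u hu z hz hu0 huz => by
            by_contra hz0
            rcases hadj u z huz with h' | h'
            · exact hz0 (h' ▸ hu0)
            · rcases all5 (φ z) with h | h | h | h | h
              · exact hz0 h
              · exact c2 ((hv2 z).1 h ▸ hz)
              · rw [hu0, h, H3_adj] at h'
                revert h'; decide
              · exact hcon z h hz
              · exact c5 z h hz) c1 hφ1
          have := t2an S (fun h => by
            have := hall a h
            rw [ha] at this
            revert this; decide)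
          linarith
        obtain ⟨x, hx, hxS⟩ := this
        have := t3x S x hx hxS
        have := t2lt S (by
          by_contra h
          linarith)
        linarith

theorem stmt_9 (G : SimpleGraph V) (hG : G.Connected) (φ : V → Fin 5)
    (hφ : ContractibleTo G H3graph φ)
    (h2conn : (G.induce (φ ⁻¹' {1})).Connected)
    (h4conn : (G.induce (φ ⁻¹' {3})).Connected)
    (h1card : (φ ⁻¹' {0}).ncard = 1)
    (h2card : (φ ⁻¹' {1}).ncard = 1)
    (h3conn : (G.induce (φ ⁻¹' {2})).Connected)
    (v4 : V) (hv4 : φ v4 = 3)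
    (hv4V3 : ∃ a ∈ φ ⁻¹' {2}, G.Adj v4 a)
    (hv4V5 : ∀ b ∈ φ ⁻¹' ({3} : Set (Fin 5)), ∀ c ∈ φ ⁻¹' ({4} : Set (Fin 5)),
      G.Adj b c → b = v4) :
    ¬ InGcs G := by
  obtain ⟨hsurj, hφ⟩ := hφ
  obtain ⟨v1, e0⟩ := Set.ncard_eq_one.mp h1card
  obtain ⟨v2, e1⟩ := Set.ncard_eq_one.mp h2card
  have hv1 : ∀ v, φ v = 0 ↔ v = v1 := fun v => by
    have := Set.ext_iff.mp e0 v
    simpa using this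
  have hv2 : ∀ v, φ v = 1 ↔ v = v2 := fun v => by
    have := Set.ext_iff.mp e1 v
    simpa using this
  have hφ1 : φ v1 = 0 := (hv1 v1).2 rfl
  have hφ2 : φ v2 = 1 := (hv2 v2).2 rfl
  obtain ⟨a, ha, hva⟩ := hv4V3
  have ha : φ a = 2 := ha
  have hadj : ∀ x y, G.Adj x y → φ x = φ y ∨ H3graph.Adj (φ x) (φ y) := by
    intro x y h
    by_cases hxy : φ x = φ y
    · exact Or.inl hxy
    · exact Or.inr ((hφ _ _ hxy).1 ⟨x, y, rfl, rfl, h⟩)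
  have all5 : ∀ i : Fin 5, i = 0 ∨ i = 1 ∨ i = 2 ∨ i = 3 ∨ i = 4 := by decide
  have h12 : G.Adj v1 v2 := by
    obtain ⟨x, y, hx, hy, h⟩ := (hφ 0 1 (by decide)).2 ((H3_adj _ _).2 (by decide))
    rw [(hv1 x).1 hx, (hv2 y).1 hy] at h
    exact h
  have h14 : ∃ p, φ p = 3 ∧ G.Adj v1 p := by
    obtain ⟨x, y, hx, hy, h⟩ := (hφ 0 3 (by decide)).2 ((H3_adj _ _).2 (by decide))
    rw [(hv1 x).1 hx] at h
    exact ⟨y, hy, h⟩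
  have h23 : ∃ b, φ b = 2 ∧ G.Adj v2 b := by
    obtain ⟨x, y, hx, hy, h⟩ := (hφ 1 2 (by decide)).2 ((H3_adj _ _).2 (by decide))
    rw [(hv2 x).1 hx] at h
    exact ⟨y, hy, h⟩
  have h25 : ∃ d, φ d = 4 ∧ G.Adj v2 d := by
    obtain ⟨x, y, hx, hy, h⟩ := (hφ 1 4 (by decide)).2 ((H3_adj _ _).2 (by decide))
    rw [(hv2 x).1 hx] at h
    exact ⟨y, hy, h⟩
  have h45 : ∃ d, φ d = 4 ∧ G.Adj v4 d := by
    obtain ⟨x, y, hx, hy, h⟩ := (hφ 3 4 (by decide)).2 ((H3_adj _ _).2 (by decide))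
    rw [hv4V5 x hx y hy h] at h
    exact ⟨y, hy, h⟩
  -- the weights
  obtain ⟨u5, D, hu5, hD⟩ := weight5 G (φ ⁻¹' {4})
  obtain ⟨δ0, hδ0, hgap0⟩ := exists_lb (Set V) (fun T => 1 - setWeight u5 T)
  obtain ⟨δ1, hδ1, hlb1⟩ := exists_lb V u5
  obtain ⟨δ, hδ, hδa, hδb, hδc⟩ : ∃ δ : ℝ, 0 < δ ∧ δ ≤ δ0 ∧ δ ≤ δ1 ∧ δ ≤ 1 :=
    ⟨min δ0 (min δ1 1), by positivity, min_le_left _ _,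
      (min_le_right _ _).trans (min_le_left _ _), (min_le_right _ _).trans (min_le_right _ _)⟩
  obtain ⟨u3, hu3, hu3s, hu3a⟩ := conc (φ ⁻¹' {2}) a ha (δ / 10) (by positivity) (by linarith)
  obtain ⟨η0, hη0, hlb3⟩ := exists_lb V u3
  obtain ⟨η, hη, hηa, hηb⟩ : ∃ η : ℝ, 0 < η ∧ η ≤ η0 ∧ η ≤ δ / 10 :=
    ⟨min η0 (δ / 10), by positivity, min_le_left _ _, min_le_right _ _⟩
  obtain ⟨u4, hu4, hu4s, hu4a⟩ := conc (φ ⁻¹' {3}) v4 hv4 (η / 10) (by positivity) (by linarith)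
  let w : V → ℝ := fun v =>
    if φ v = 2 then u3 v else if φ v = 3 then u4 v else if φ v = 4 then u5 v else 1
  have hw : ∀ v, 0 < w v := by
    intro v
    simp only [w]
    split_ifs
    · exact hu3 v
    · exact hu4 v
    · exact hu5 v
    · exact one_pos
  have wq2 : ∀ v, φ v = 2 → w v = u3 v := fun v h => by simp [w, h]
  have wq3 : ∀ v, φ v = 3 → w v = u4 v := fun v h => by simp [w, h]
  have wq4 : ∀ v, φ v = 4 → w v = u5 v := fun v h => by simp [w, h]
  have w1 : w v1 = 1 := by simp [w, hφ1]
  have w2 : w v2 = 1 := by simp [w, hφ2]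
  have W3 : setWeight w (φ ⁻¹' {2}) = 1 := by rw [sw_congr (A := φ ⁻¹' {2}) (u := u3) wq2, hu3s]
  have W4 : setWeight w (φ ⁻¹' {3}) = 1 := by rw [sw_congr (A := φ ⁻¹' {3}) (u := u4) wq3, hu4s]
  have W5 : ∀ T : Set V, T ⊆ φ ⁻¹' {4} → setWeight w T = setWeight u5 T :=
    fun T hT => sw_congr (fun v hv => wq4 v (hT hv))
  have core : ∀ S : Set V, IsConnSafeSet G w S → ¬ setWeight w S ≤ 2 := by
    intro S hS hS2
    refine no_small_conn G φ w hw hadj v1 v2 v4 a D δ η (δ / 10) (η / 10) hv1 hv2 hv4 ha hva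
      h12 h14 h23 h25 h45 (fun b c hb hc h => hv4V5 b hb c hc h) h3conn.preconnected
      h4conn.preconnected hδ hη (by positivity) (by positivity) hδc (by linarith) (by linarith)
      (by linarith) w1 w2 W3 W4 (by rw [wq2 a ha]; exact hu3a) (by rw [wq3 v4 hv4]; exact hu4a)
      ?_ ?_ ?_ ?_ S hS.1.1 hS.2.preconnected hS2 (fun v hv => connsafe_comp hG hw hS hv)
    · intro v hv
      rw [wq2 v hv]
      exact hηa.trans (hlb3 v (hu3 v))
    · intro v hv
      rw [wq4 v hv]
      exact hδb.trans (hlb1 v (hu5 v))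
    · intro T hT h
      rw [W5 T hT] at h ⊢
      have := hgap0 T (by linarith)
      linarith
    · intro x hx
      obtain ⟨-, h2, h3, -, h5⟩ := hD x hx
      exact ⟨h2, by rw [W5 _ h2, h3], h5⟩
  -- the disconnected safe set
  let S0 : Set V := {x | φ x = 1 ∨ φ x = 3}
  have hS0 : IsSafeSet G w S0 := by
    refine ⟨⟨v2, Or.inl hφ2⟩, ?_, ?_⟩
    · intro h
      have : v1 ∈ S0 := h ▸ Set.mem_univ v1
      simp [S0, hφ1] at this
    · intro C K hC hK _
      have hC1 : 1 ≤ setWeight w C := by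
        obtain ⟨x, hxC, hxS⟩ := comp_mem hC
        rcases hxS with h | h
        · rw [← w2, ← (hv2 x).1 h]
          exact sw_mem hw hxC
        · rw [← W4]
          apply sw_mono hw
          exact cut h4conn.preconnected (fun y => y ∈ C)
            (fun y _ z hz hy hyz => comp_closed hC hy (Or.inr hz) hyz) h hxC
      have hK1 : setWeight w K ≤ 1 := by
        obtain ⟨x, hxK, hxS⟩ := comp_mem hK
        have same : ∀ y ∈ S0ᶜ, ∀ z ∈ S0ᶜ, G.Adj y z → φ y = φ z := by
          intro y hy z hz hyz
          rcases hadj y z hyz with h | h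
          · exact h
          · rw [H3_adj] at h
            rcases h with h | h
            · exact absurd h.1 hy
            · exact absurd h.1 hz
        have hsub : K ⊆ φ ⁻¹' {φ x} := comp_cut hK (fun y => φ y = φ x)
          (fun y hy z hz h hyz => (same y hy z hz hyz).symm.trans h) hxK rfl
        rcases all5 (φ x) with h | h | h | h | h
        · rw [h, e0] at hsub
          rw [← w1, ← sw_single (w := w) v1]
          exact sw_mono hw hsub
        · exact absurd (Or.inl h) hxS
        · rw [h] at hsub
          rw [← W3]
          exact sw_mono hw hsub
        · exact absurd (Or.inr h) hxS
        · obtain ⟨h1, h2, h3, h4, h5⟩ := hD x h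
          rw [h] at hsub
          rw [← h3, ← W5 _ h2]
          apply sw_mono hw
          refine fun y hy => (comp_cut hK (fun y => y ∈ D x ∧ φ y = 4) ?_ hxK ⟨h1, h⟩ y hy).1
          intro y hy z hz hyD hyz
          have hz4 : φ z = 4 := (same y hy z hz hyz).symm.trans hyD.2
          exact ⟨h4 y hyD.1 z hz4 hyz, hz4⟩
      linarith
  have hW0 : setWeight w S0 = 2 := by
    have : S0 = {v2} ∪ φ ⁻¹' {3} := by
      ext x
      simp [S0, hv2]
    rw [this, sw_union, sw_single, w2, W4]
    · norm_num
    · rintro v hv hv3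
      rw [Set.mem_singleton_iff] at hv
      have hv3 : φ v = 3 := hv3
      rw [hv, hφ2] at hv3
      revert hv3; decide
  intro hin
  have heq := hin w hw
  have fin1 : (setWeight w '' {S | IsSafeSet G w S}).Finite := Set.toFinite _
  have fin2 : (setWeight w '' {S | IsConnSafeSet G w S}).Finite := Set.toFinite _
  have ne1 : (setWeight w '' {S | IsSafeSet G w S}).Nonempty := ⟨_, S0, hS0, rfl⟩
  have hs2 : safeNumber G w ≤ 2 := by
    rw [← hW0]
    exact csInf_le fin1.bddBelow ⟨S0, hS0, rfl⟩
  have hspos : 0 < safeNumber G w := by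
    obtain ⟨S, hS, hSe⟩ := ne1.csInf_mem fin1
    unfold safeNumber
    rw [← hSe]
    obtain ⟨x, hx⟩ := hS.1
    exact (hw x).trans_le (sw_mem hw hx)
  by_cases ne2 : (setWeight w '' {S | IsConnSafeSet G w S}).Nonempty
  · obtain ⟨S, hS, hSe⟩ := ne2.csInf_mem fin2
    apply core S hS
    rw [hSe]
    change connSafeNumber G w ≤ 2
    rw [← heq]
    exact hs2
  · rw [Set.not_nonempty_iff_eq_empty] at ne2
    rw [heq] at hspos
    unfold connSafeNumber at hspos
    rw [ne2, Real.sInf_empty] at hspos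
    exact lt_irrefl _ hspos
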